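/- Let p_1,…,p_r be positive integers with Σ_j p_j = 2T and let K be a real number with K ≥ 2rT. Consider the instance with 4 agents and items o_1,…,o_{r+3}, where agents 1 and 2 have cost p_j on each o_j (j ≤ r) and cost K on each of o_{r+1}, o_{r+2}, o_{r+3}; agent 3 has cost p_j on each o_j (j ≤ r), cost T on each of o_{r+1} and o_{r+2}, and cost 3K − 2T on o_{r+3}; and agent 4 has cost (K + 2T)/r on each o_j (j ≤ r), cost K on each of o_{r+1} and o_{r+2}, and cost 0 on o_{r+3} (so each agent's total cost is 3K + 2T). Then: (a) if {1,…,r} admits a partition into I₁, I₂ with Σ_{j∈I₁} p_j = Σ_{j∈I₂} p_j = T, then the allocation A₁ = {o_j : j ∈ I₁}, A₂ = {o_j : j ∈ I₂}, A₃ = {o_{r+1}, o_{r+2}}, A₄ = {o_{r+3}} is EF1 and has social cost 4T, which equals the minimum social cost over all allocations; and (b) if no such partition exists, then every EF1 allocation of this instance has social cost at least K. -/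

import Mathlib

open Finset

/-- `A` is an allocation: the bundles are pairwise disjoint and every item is assigned. -/
def IsAllocation {n : ℕ} {ι : Type*} (A : Fin n → Finset ι) : Prop :=
  (∀ i j : Fin n, i ≠ j → Disjoint (A i) (A j)) ∧ ∀ o : ι, ∃ i : Fin n, o ∈ A i

/-- The social cost of an allocation. -/
def SC {n : ℕ} {ι : Type*} (c : Fin n → ι → ℝ) (A : Fin n → Finset ι) : ℝ :=
  ∑ i, ∑ o ∈ A i, c i o

/-- Envy-freeness up to one item (for chores). -/
def EF1 {n : ℕ} {ι : Type*} [DecidableEq ι] (c : Fin n → ι → ℝ)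
    (A : Fin n → Finset ι) : Prop :=
  ∀ i j : Fin n, ∃ S ⊆ A i, S.card ≤ 1 ∧ ∑ o ∈ A i \ S, c i o ≤ ∑ o ∈ A j, c i o

/-- Items are `Fin r ⊕ Fin 3`, where `Sum.inr 0, Sum.inr 1, Sum.inr 2` are
`o_{r+1}, o_{r+2}, o_{r+3}`.  Agents `1, 2` (indices `0, 1`) have costs `p_j, K, K, K`;
agent `3` (index 2) has costs `p_j, T, T, 3K - 2T`; agent `4` (index 3) has costs
`(K+2T)/r, K, K, 0`. -/
noncomputable def cFour (r T : ℕ) (p : Fin r → ℕ) (K : ℝ) (i : Fin 4) :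
    Fin r ⊕ Fin 3 → ℝ := fun o =>
  match o with
  | Sum.inl j => if (i : ℕ) ≤ 2 then (p j : ℝ) else (K + 2 * T) / r
  | Sum.inr k =>
      if (i : ℕ) ≤ 1 then K
      else if (i : ℕ) = 2 then (if (k : ℕ) ≤ 1 then (T : ℝ) else 3 * K - 2 * T)
      else (if (k : ℕ) ≤ 1 then K else 0)

/-- The allocation `A₁ = {o_j : j ∈ I}`, `A₂ = {o_j : j ∉ I}`, `A₃ = {o_{r+1}, o_{r+2}}`,
`A₄ = {o_{r+3}}`. -/
def allocFour (r : ℕ) (I : Finset (Fin r)) : Fin 4 → Finset (Fin r ⊕ Fin 3) := fun i =>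
  if i = 0 then I.image Sum.inl
  else if i = 1 then (Iᶜ).image Sum.inl
  else if i = 2 then {Sum.inr 0, Sum.inr 1}
  else {Sum.inr 2}

theorem IsAllocation.exists_owner {n : ℕ} {ι : Type*} {A : Fin n → Finset ι}
    (hA : IsAllocation A) : ∃ f : ι → Fin n, ∀ o i, o ∈ A i ↔ f o = i := by
  choose f hf using hA.2
  refine ⟨f, fun o i => ⟨fun h => ?_, fun h => h ▸ hf o⟩⟩
  by_contra hne
  exact disjoint_left.1 (hA.1 _ _ hne) (hf o) h

theorem SC_eq_sum_owner {n : ℕ} {ι : Type*} [Fintype ι] {A : Fin n → Finset ι}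
    (c : Fin n → ι → ℝ) {f : ι → Fin n} (hf : ∀ o i, o ∈ A i ↔ f o = i) :
    SC c A = ∑ o, c (f o) o := by
  have hA : ∀ i, A i = univ.filter (fun o => f o = i) := fun i => by ext o; simp [hf]
  rw [SC, ← Finset.sum_fiberwise univ f]
  refine sum_congr rfl fun i _ => ?_
  rw [hA]
  refine sum_congr rfl fun o ho => ?_
  rw [(mem_filter.1 ho).2]

theorem isAllocation_allocFour {r : ℕ} (I : Finset (Fin r)) :
    IsAllocation (allocFour r I) := by
  constructor
  · intro i j hij
    rw [disjoint_left]
    fin_cases i <;> fin_cases j <;> simp [allocFour] at hij ⊢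
    all_goals grind
  · rintro (j | k)
    · by_cases h : j ∈ I
      · exact ⟨0, by simp [allocFour, h]⟩
      · exact ⟨1, by simp [allocFour, h]⟩
    · fin_cases k
      · exact ⟨2, by simp [allocFour]⟩
      · exact ⟨2, by simp [allocFour]⟩
      · exact ⟨3, by simp [allocFour]⟩

theorem two_mul_le_of_sum_eq {r T : ℕ} {p : Fin r → ℕ} (hsum : ∑ j, p j = 2 * T) {K : ℝ}
    (hK : 2 * (r : ℝ) * T ≤ K) : 2 * (T : ℝ) ≤ K := by
  rcases Nat.eq_zero_or_pos r with rfl | hr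
  · have : T = 0 := by simpa using hsum.symm
    subst this
    simpa using hK
  · have : (1 : ℝ) ≤ r := by exact_mod_cast hr
    nlinarith [(Nat.cast_nonneg T : (0 : ℝ) ≤ T)]

theorem le_cFour_inl {r T : ℕ} {p : Fin r → ℕ} (hsum : ∑ j, p j = 2 * T) {K : ℝ}
    (hK : 2 * (r : ℝ) * T ≤ K) (i : Fin 4) (j : Fin r) :
    (p j : ℝ) ≤ cFour r T p K i (Sum.inl j) := by
  simp only [cFour]
  split_ifs
  · exact le_rfl
  · have hr : (0 : ℝ) < r := by exact_mod_cast (Nat.zero_le _).trans_lt j.2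
    have hj : (p j : ℝ) ≤ 2 * T := by
      exact_mod_cast hsum ▸ single_le_sum (f := p) (fun _ _ => Nat.zero_le _) (mem_univ j)
    rw [le_div_iff₀ hr]
    nlinarith [(Nat.cast_nonneg T : (0 : ℝ) ≤ T)]

theorem le_cFour_inr {r T : ℕ} (p : Fin r → ℕ) {K : ℝ} (hTK : 2 * (T : ℝ) ≤ K)
    (i : Fin 4) (k : Fin 3) :
    (if (k : ℕ) ≤ 1 then (T : ℝ) else 0) ≤ cFour r T p K i (Sum.inr k) := by
  have hT : (0 : ℝ) ≤ T := Nat.cast_nonneg T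
  simp only [cFour]
  split_ifs <;> linarith

theorem cFour_nonneg {r T : ℕ} {p : Fin r → ℕ} (hsum : ∑ j, p j = 2 * T) {K : ℝ}
    (hK : 2 * (r : ℝ) * T ≤ K) (i : Fin 4) (o : Fin r ⊕ Fin 3) :
    0 ≤ cFour r T p K i o := by
  rcases o with j | k
  · exact (Nat.cast_nonneg _).trans (le_cFour_inl hsum hK i j)
  · refine le_trans ?_ (le_cFour_inr p (two_mul_le_of_sum_eq hsum hK) i k)
    split_ifs <;> simp

theorem SC_allocFour {r T : ℕ} {p : Fin r → ℕ} {K : ℝ} {I : Finset (Fin r)}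
    (h1 : ∑ j ∈ I, p j = T) (h2 : ∑ j ∈ Iᶜ, p j = T) :
    SC (cFour r T p K) (allocFour r I) = 4 * T := by
  have h1' : ∑ j ∈ I, (p j : ℝ) = T := by exact_mod_cast h1
  have h2' : ∑ j ∈ Iᶜ, (p j : ℝ) = T := by exact_mod_cast h2
  simp [SC, Fin.sum_univ_four, allocFour, cFour, h1', h2']
  ring

theorem four_mul_le_SC {r T : ℕ} {p : Fin r → ℕ} (hsum : ∑ j, p j = 2 * T) {K : ℝ}
    (hK : 2 * (r : ℝ) * T ≤ K) {B : Fin 4 → Finset (Fin r ⊕ Fin 3)} (hB : IsAllocation B) :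
    4 * (T : ℝ) ≤ SC (cFour r T p K) B := by
  obtain ⟨f, hf⟩ := hB.exists_owner
  rw [SC_eq_sum_owner _ hf, Fintype.sum_sum_type]
  have hl := sum_le_sum fun j (_ : j ∈ univ) => le_cFour_inl hsum hK (f (Sum.inl j)) j
  have hr := sum_le_sum fun k (_ : k ∈ univ) =>
    le_cFour_inr p (two_mul_le_of_sum_eq hsum hK) (f (Sum.inr k)) k
  have hs : ∑ j, (p j : ℝ) = 2 * T := by exact_mod_cast hsum
  rw [hs] at hl
  rw [Fin.sum_univ_three] at hr
  norm_num at hr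
  linarith

theorem EF1_allocFour {r T : ℕ} {p : Fin r → ℕ} {K : ℝ} (hTK : 2 * (T : ℝ) ≤ K)
    {I : Finset (Fin r)} (h1 : ∑ j ∈ I, p j = T) (h2 : ∑ j ∈ Iᶜ, p j = T) :
    EF1 (cFour r T p K) (allocFour r I) := by
  have hT : (0 : ℝ) ≤ T := Nat.cast_nonneg T
  have h1' : ∑ j ∈ I, (p j : ℝ) = T := by exact_mod_cast h1
  have h2' : ∑ j ∈ Iᶜ, (p j : ℝ) = T := by exact_mod_cast h2
  have hA₂ : ({Sum.inr 0, Sum.inr 1} : Finset (Fin r ⊕ Fin 3)) \ {Sum.inr 0} = {Sum.inr 1} := by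
    ext o
    simp
    grind
  have hK' : 0 ≤ (K + 2 * T) / r := div_nonneg (by linarith) (Nat.cast_nonneg r)
  intro i j
  fin_cases i
  · refine ⟨∅, by simp, by simp, ?_⟩
    fin_cases j <;> simp [allocFour, cFour, h1', h2'] <;> linarith
  · refine ⟨∅, by simp, by simp, ?_⟩
    fin_cases j <;> simp [allocFour, cFour, h1', h2'] <;> linarith
  · refine ⟨{Sum.inr 0}, by simp [allocFour], by simp, ?_⟩
    fin_cases j <;> simp [allocFour, cFour, h1', h2', hA₂]
    linarith
  · refine ⟨{Sum.inr 2}, by simp [allocFour], by simp, ?_⟩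
    fin_cases j <;> simp [allocFour, cFour] <;> first | positivity | linarith

theorem le_SC_of_EF1 {r T : ℕ} {p : Fin r → ℕ} (hsum : ∑ j, p j = 2 * T) {K : ℝ}
    (hK : 2 * (r : ℝ) * T ≤ K) (hI : ¬ ∃ I : Finset (Fin r), ∑ j ∈ I, p j = T)
    {B : Fin 4 → Finset (Fin r ⊕ Fin 3)} (hB : IsAllocation B) (hEF : EF1 (cFour r T p K) B) :
    K ≤ SC (cFour r T p K) B := by
  by_contra! hlt
  obtain ⟨f, hf⟩ := hB.exists_owner
  have hcost : ∀ o, cFour r T p K (f o) o < K := fun o => by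
    rw [SC_eq_sum_owner _ hf] at hlt
    exact (single_le_sum (f := fun o => cFour r T p K (f o) o)
      (fun o _ => cFour_nonneg hsum hK _ o) (mem_univ o)).trans_lt hlt
  have hf0 : f (Sum.inr 0) = 2 := by
    have h := hcost (Sum.inr 0)
    generalize f (Sum.inr 0) = i at h ⊢
    fin_cases i <;> simp [cFour] at h ⊢
  have hf1 : f (Sum.inr 1) = 2 := by
    have h := hcost (Sum.inr 1)
    generalize f (Sum.inr 1) = i at h ⊢
    fin_cases i <;> simp [cFour] at h ⊢
  have hinr : ∀ i : Fin 4, (i : ℕ) ≤ 1 → ∀ k, Sum.inr k ∉ B i := fun i hi k hk => by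
    have h := hcost (Sum.inr k)
    rw [(hf _ _).1 hk] at h
    simp [cFour, hi] at h
  have hB_eq : ∀ i : Fin 4, (i : ℕ) ≤ 1 →
      B i = (univ.filter fun j => f (Sum.inl j) = i).image Sum.inl := fun i hi => by
    ext o
    rcases o with j | k
    · simp [hf]
    · simp [hinr i hi k]
  have hge : ∀ i : Fin 4, (i : ℕ) ≤ 1 → T ≤ ∑ j with f (Sum.inl j) = i, p j := fun i hi => by
    obtain ⟨S, -, hS, hle⟩ := hEF 2 i
    have hsum_i : ∑ o ∈ B i, cFour r T p K 2 o = ∑ j with f (Sum.inl j) = i, (p j : ℝ) := by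
      rw [hB_eq i hi]
      simp [cFour]
    obtain ⟨k, hk, hkS⟩ : ∃ k : Fin 3, (k = 0 ∨ k = 1) ∧ Sum.inr k ∉ S := by
      by_contra! h
      have := card_le_one.1 hS _ (h 0 (Or.inl rfl)) _ (h 1 (Or.inr rfl))
      simp at this
    have hmem : Sum.inr k ∈ B 2 \ S := by
      rw [mem_sdiff, hf]
      rcases hk with rfl | rfl
      exacts [⟨hf0, hkS⟩, ⟨hf1, hkS⟩]
    have hTle := single_le_sum (f := cFour r T p K 2)
      (fun o _ => cFour_nonneg hsum hK 2 o) hmem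
    have hTeq : cFour r T p K 2 (Sum.inr k) = T := by
      rcases hk with rfl | rfl <;> simp [cFour]
    rw [hTeq] at hTle
    rw [hsum_i] at hle
    exact_mod_cast hTle.trans hle
  have hdisj : Disjoint (univ.filter fun j => f (Sum.inl j) = 0)
      (univ.filter fun j => f (Sum.inl j) = 1) := by
    rw [disjoint_filter]
    intro j _ h
    simp [h]
  have hle : ∑ j with f (Sum.inl j) = 0, p j + ∑ j with f (Sum.inl j) = 1, p j ≤ 2 * T := by
    rw [← sum_union hdisj, ← hsum]
    exact sum_le_sum_of_subset (subset_univ _)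
  have h0 := hge 0 (by simp)
  have h1 := hge 1 (by simp)
  exact hI ⟨_, le_antisymm (by omega) h0⟩

theorem ef1_unbounded_multiplicative_instance (r T : ℕ) (p : Fin r → ℕ)
    (hp : ∀ j, 0 < p j) (hsum : ∑ j, p j = 2 * T) (K : ℝ) (hK : 2 * (r : ℝ) * T ≤ K) :
    ((∀ I : Finset (Fin r), ∑ j ∈ I, p j = T → ∑ j ∈ Iᶜ, p j = T →
        IsAllocation (allocFour r I) ∧ EF1 (cFour r T p K) (allocFour r I) ∧
          SC (cFour r T p K) (allocFour r I) = 4 * T ∧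
          (∀ B : Fin 4 → Finset (Fin r ⊕ Fin 3), IsAllocation B →
            SC (cFour r T p K) (allocFour r I) ≤ SC (cFour r T p K) B))) ∧
    ((¬ ∃ I : Finset (Fin r), ∑ j ∈ I, p j = T) →
      ∀ B : Fin 4 → Finset (Fin r ⊕ Fin 3), IsAllocation B → EF1 (cFour r T p K) B →
        K ≤ SC (cFour r T p K) B) := by
  have hTK := two_mul_le_of_sum_eq hsum hK
  refine ⟨fun I h1 h2 => ⟨isAllocation_allocFour I, EF1_allocFour hTK h1 h2, SC_allocFour h1 h2,
    fun B hB => ?_⟩, fun hI B hB hEF => le_SC_of_EF1 hsum hK hI hB hEF⟩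
  rw [SC_allocFour h1 h2]
  exact four_mul_le_SC hsum hK hB
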